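/- Let J_C be a neural ideal and let Ĝ be the universal Gröbner basis of J_C (the union of all reduced Gröbner bases). The following are equivalent: (1) CF(J_C) is a Gröbner basis of J_C for some monomial ordering; (2) CF(J_C) = Ĝ; (3) every element of Ĝ is a pseudo-monomial. -/

import Mathlib

open MvPolynomial

universe u

/-- The pseudo-monomial `x_σ * ∏_{j ∈ τ} (1 + x_j)` in `F₂[x₁,…,xₙ]`. -/
noncomputable def psm {n : ℕ} (σ τ : Finset (Fin n)) : MvPolynomial (Fin n) (ZMod 2) :=
  (∏ i ∈ σ, X i) * ∏ j ∈ τ, (1 + X j)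

/-- A polynomial is a pseudo-monomial if it equals `psm σ τ` for disjoint `σ τ`. -/
def IsPseudoMonomial {n : ℕ} (f : MvPolynomial (Fin n) (ZMod 2)) : Prop :=
  ∃ σ τ : Finset (Fin n), Disjoint σ τ ∧ f = psm σ τ

/-- The characteristic polynomial `ρ_v = ∏ i (1 - v_i - x_i)` of a point `v ∈ {0,1}ⁿ`. -/
noncomputable def rho {n : ℕ} (v : Fin n → ZMod 2) : MvPolynomial (Fin n) (ZMod 2) :=
  ∏ i, (1 - C (v i) - X i)

/-- The neural ideal `J_C` of a code `Co ⊆ {0,1}ⁿ`. -/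
noncomputable def neuralIdeal {n : ℕ} (Co : Set (Fin n → ZMod 2)) :
    Ideal (MvPolynomial (Fin n) (ZMod 2)) :=
  Ideal.span {p | ∃ v, v ∉ Co ∧ p = rho v}

/-- The canonical form: the set of minimal pseudo-monomials of an ideal. -/
def canonicalForm {n : ℕ} (J : Ideal (MvPolynomial (Fin n) (ZMod 2))) :
    Set (MvPolynomial (Fin n) (ZMod 2)) :=
  {f | IsPseudoMonomial f ∧ f ∈ J ∧
    ∀ g : MvPolynomial (Fin n) (ZMod 2), IsPseudoMonomial g → g ∈ J → g ∣ f → g = f}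

/-- The multidegree (exponent of the leading term) of `f` w.r.t. a monomial order `m`. -/
noncomputable def leadDeg {n : ℕ} (m : MonomialOrder.{0,u} (Fin n))
    (f : MvPolynomial (Fin n) (ZMod 2)) : Fin n →₀ ℕ :=
  m.toSyn.symm (f.support.sup (fun d => m.toSyn d))

/-- The exponent vector of the square-free monomial `x_ω`. -/
noncomputable def expOf {n : ℕ} (ω : Finset (Fin n)) : Fin n →₀ ℕ :=
  ∑ i ∈ ω, Finsupp.single i 1

/-- `G` is a Gröbner basis of `J` w.r.t. the monomial order `m`: a finite subset of `J`
whose leading terms generate the leading term ideal, i.e. the leading term of every nonzero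
element of `J` is divisible by the leading term of some element of `G`. -/
def IsGB {n : ℕ} (m : MonomialOrder.{0,u} (Fin n)) (J : Ideal (MvPolynomial (Fin n) (ZMod 2)))
    (G : Set (MvPolynomial (Fin n) (ZMod 2))) : Prop :=
  G.Finite ∧ G ⊆ (J : Set (MvPolynomial (Fin n) (ZMod 2))) ∧
    ∀ f ∈ J, f ≠ 0 → ∃ g ∈ G, g ≠ 0 ∧ leadDeg m g ≤ leadDeg m f

/-- A reduced Gröbner basis: every element has leading coefficient 1, and no term of any
element is divisible by the leading term of another element. -/
def IsReducedGB {n : ℕ} (m : MonomialOrder.{0,u} (Fin n))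
    (J : Ideal (MvPolynomial (Fin n) (ZMod 2)))
    (G : Set (MvPolynomial (Fin n) (ZMod 2))) : Prop :=
  IsGB m J G ∧ (∀ g ∈ G, coeff (leadDeg m g) g = 1) ∧
    ∀ f ∈ G, ∀ g ∈ G, g ≠ f → ∀ d ∈ f.support, ¬ leadDeg m g ≤ d

/-- The universal Gröbner basis: the union of all reduced Gröbner bases. -/
def universalGB {n : ℕ} (J : Ideal (MvPolynomial (Fin n) (ZMod 2))) :
    Set (MvPolynomial (Fin n) (ZMod 2)) :=
  {f | ∃ (m : MonomialOrder.{0,u} (Fin n)) (G : Set (MvPolynomial (Fin n) (ZMod 2))),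
    IsReducedGB m J G ∧ f ∈ G}

/-- The receptive field code of a family of sets `U i` in a stimulus space `S`. -/
def rfCode {n : ℕ} {S : Type} (U : Fin n → Set S) : Set (Fin n → ZMod 2) :=
  {c | ((⋂ i ∈ {i : Fin n | c i = 1}, U i) \ ⋃ j ∈ {j : Fin n | c j = 0}, U j).Nonempty}

namespace NeuralAux

variable {n : ℕ}

abbrev P (n : ℕ) := MvPolynomial (Fin n) (ZMod 2)

theorem leadDeg_eq (m : MonomialOrder.{0,u} (Fin n)) (f : P n) : leadDeg m f = m.degree f := rfl

theorem one_of_ne {a : ZMod 2} (h : a ≠ 0) : a = 1 := by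
  revert h; revert a; decide

theorem unitLC (m : MonomialOrder.{0,u} (Fin n)) {f : P n} (hf : f ≠ 0) :
    IsUnit (m.leadingCoeff f) :=
  isUnit_iff_ne_zero.2 (m.leadingCoeff_ne_zero_iff.2 hf)

theorem exists_order : Nonempty (MonomialOrder.{0,u} (Fin n)) := by
  let m₀ : MonomialOrder.{0,0} (Fin n) := MonomialOrder.lex
  exact ⟨{
    syn := ULift.{u} m₀.syn
    isOrderedAddMonoid_syn := ⟨fun a b h c => add_le_add_left (α := m₀.syn) h c.down,
      fun a b h c => add_le_add_right (α := m₀.syn) h c.down⟩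
    toSyn := m₀.toSyn.trans AddEquiv.ulift.symm
    toSyn_monotone := fun a b h => m₀.toSyn_monotone h }⟩

theorem one_add_X_ne (i : Fin n) : (1 + X i : P n) ≠ 0 := by
  intro h
  have := congrArg (eval (fun _ => (0 : ZMod 2))) h
  simp at this

theorem psm_ne (σ τ : Finset (Fin n)) : psm σ τ ≠ 0 :=
  mul_ne_zero (Finset.prod_ne_zero_iff.2 fun i _ => X_ne_zero i)
    (Finset.prod_ne_zero_iff.2 fun i _ => one_add_X_ne i)

theorem degree_one_add_X (m : MonomialOrder.{0,u} (Fin n)) (i : Fin n) :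
    m.degree (1 + X i : P n) = Finsupp.single i 1 := by
  rw [MonomialOrder.degree_add_eq_right_of_lt, m.degree_X]
  rw [m.degree_X, ← C_1, m.degree_C, map_zero, m.toSyn_lt_iff_ne_zero]
  simp

theorem degree_prod' (m : MonomialOrder.{0,u} (Fin n)) (s : Finset (Fin n)) (f : Fin n → P n)
    (hf : ∀ i, f i ≠ 0) : m.degree (∏ i ∈ s, f i) = ∑ i ∈ s, m.degree (f i) := by
  classical
  induction s using Finset.induction_on with
  | empty => simp [← C_1, m.degree_C, -map_one]
  | insert a s ha ih =>
    rw [Finset.prod_insert ha, Finset.sum_insert ha,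
      m.degree_mul (hf a) (Finset.prod_ne_zero_iff.2 fun i _ => hf i), ih]

theorem degree_psm (m : MonomialOrder.{0,u} (Fin n)) (σ τ : Finset (Fin n)) :
    m.degree (psm σ τ) = expOf σ + expOf τ := by
  unfold psm
  rw [m.degree_mul (Finset.prod_ne_zero_iff.2 fun i _ => X_ne_zero i)
    (Finset.prod_ne_zero_iff.2 fun i _ => one_add_X_ne i),
    degree_prod' m _ _ (fun i => X_ne_zero i), degree_prod' m _ _ one_add_X_ne]
  simp [m.degree_X, degree_one_add_X, expOf]

theorem expOf_apply (σ : Finset (Fin n)) (i : Fin n) : expOf σ i = if i ∈ σ then 1 else 0 := by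
  classical
  simp [expOf, Finsupp.finsetSum_apply, Finsupp.single_apply]

theorem psm_sub (m : MonomialOrder.{0,u} (Fin n)) {σ τ : Finset (Fin n)} {d : Fin n →₀ ℕ}
    (h : m.degree (psm σ τ) ≤ d) : σ ⊆ d.support ∧ τ ⊆ d.support := by
  rw [degree_psm] at h
  constructor
  · intro i hi
    have := h i
    simp only [Finsupp.add_apply, expOf_apply, hi, if_true] at this
    rw [Finsupp.mem_support_iff]; omega
  · intro i hi
    have := h i
    simp only [Finsupp.add_apply, expOf_apply, hi, if_true] at this
    rw [Finsupp.mem_support_iff]; omega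

theorem psm_dvd {σ τ σ' τ' : Finset (Fin n)} (h : σ' ⊆ σ) (h' : τ' ⊆ τ) :
    psm σ' τ' ∣ psm σ τ :=
  mul_dvd_mul (Finset.prod_dvd_prod_of_subset _ _ _ h) (Finset.prod_dvd_prod_of_subset _ _ _ h')

theorem IsPM.ne {f : P n} (h : IsPseudoMonomial f) : f ≠ 0 := by
  obtain ⟨σ, τ, -, rfl⟩ := h
  exact psm_ne _ _

theorem pm_degree (m m' : MonomialOrder.{0,u} (Fin n)) {f : P n} (h : IsPseudoMonomial f) :
    m.degree f = m'.degree f := by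
  obtain ⟨σ, τ, -, rfl⟩ := h
  rw [degree_psm, degree_psm]

theorem cf_finite (J : Ideal (P n)) : (canonicalForm J).Finite := by
  apply (Set.finite_range (fun p : Finset (Fin n) × Finset (Fin n) => psm p.1 p.2)).subset
  rintro f ⟨⟨σ, τ, -, rfl⟩, -⟩
  exact ⟨(σ, τ), rfl⟩

theorem cf_sub (J : Ideal (P n)) : canonicalForm J ⊆ (J : Set (P n)) := fun _ h => h.2.1

theorem exists_cf (J : Ideal (P n)) {f : P n} (hf : IsPseudoMonomial f) (hJ : f ∈ J) :
    ∃ g ∈ canonicalForm J, g ∣ f := by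
  classical
  have hex : ∃ k, ∃ g : P n, IsPseudoMonomial g ∧ g ∈ J ∧ g ∣ f ∧ g.totalDegree = k :=
    ⟨_, f, hf, hJ, dvd_rfl, rfl⟩
  obtain ⟨g, hg, hgJ, hgf, hk⟩ := Nat.find_spec hex
  refine ⟨g, ⟨hg, hgJ, ?_⟩, hgf⟩
  rintro g' hg' hg'J ⟨c, hc⟩
  have h1 : Nat.find hex ≤ g'.totalDegree :=
    Nat.find_min' hex ⟨g', hg', hg'J, (Dvd.intro c hc.symm).trans hgf, rfl⟩
  have hc0 : c ≠ 0 := by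
    rintro rfl
    exact IsPM.ne hg (by simpa using hc)
  have h2 : g.totalDegree = g'.totalDegree + c.totalDegree := by
    rw [hc]; exact totalDegree_mul_of_isDomain (IsPM.ne hg') hc0
  have h3 : c.totalDegree = 0 := by omega
  rw [totalDegree_eq_zero_iff_eq_C] at h3
  have h4 : coeff 0 c ≠ 0 := by
    intro h; rw [h] at h3; exact hc0 (by simpa using h3)
  rw [one_of_ne h4] at h3
  rw [hc, h3]; simp

/-- Key lemma: if the canonical form is a Groebner basis, its leading terms form an antichain. -/
theorem antichain (m : MonomialOrder.{0,u} (Fin n)) (J : Ideal (P n))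
    (hGB : IsGB m J (canonicalForm J)) {f g : P n} (hf : f ∈ canonicalForm J)
    (hg : g ∈ canonicalForm J) (hle : m.degree g ≤ m.degree f) : g = f := by
  classical
  by_contra hne
  obtain ⟨σ, τ, hd, hfe⟩ := hf.1
  let W : Set (Fin n) := ↑(σ ∪ τ)
  let v : Fin n → ZMod 2 := fun i => if i ∈ σ then 1 else 0
  have hfW : ∀ s : Finset (Fin n), s ⊆ (m.degree f).support → (s : Set (Fin n)) ⊆ W := by
    intro s hs i hi
    have := hs hi
    rw [hfe, degree_psm, Finsupp.mem_support_iff, Finsupp.add_apply, expOf_apply, expOf_apply]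
      at this
    by_contra hiW
    simp only [W, Finset.coe_union, Set.mem_union, Finset.mem_coe, not_or] at hiW
    simp [hiW] at this
  have psmW : ∀ s t : Finset (Fin n), (s : Set (Fin n)) ⊆ W → (t : Set (Fin n)) ⊆ W →
      psm s t ∈ supported (ZMod 2) W := by
    intro s t hs ht
    refine mul_mem (prod_mem fun i hi => ?_) (prod_mem fun i hi => add_mem (one_mem _) ?_)
    · exact X_mem_supported.2 (hs hi)
    · exact X_mem_supported.2 (ht hi)
  have hfv : eval v f ≠ 0 := by
    rw [hfe]
    simp only [psm, map_mul, map_prod, eval_X, map_add, map_one]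
    refine mul_ne_zero (Finset.prod_ne_zero_iff.2 fun i hi => by simp [v, hi])
      (Finset.prod_ne_zero_iff.2 fun i hi => ?_)
    have : i ∉ σ := Finset.disjoint_right.1 hd hi
    simp [v, this]
  have hvan : ∀ h ∈ canonicalForm J, h ≠ f → h ∈ supported (ZMod 2) W → eval v h = 0 := by
    intro h hh hhf hW
    obtain ⟨s, t, hst, rfl⟩ := hh.1
    by_contra hv
    simp only [psm, map_mul, map_prod, eval_X, map_add, map_one] at hv
    have hv1 := Finset.prod_ne_zero_iff.1 (left_ne_zero_of_mul hv)
    have hv2 := Finset.prod_ne_zero_iff.1 (right_ne_zero_of_mul hv)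
    have hsub := psm_sub m (le_refl (m.degree (psm s t)))
    have hWt : (t : Set (Fin n)) ⊆ W := by
      intro i hi
      rw [mem_supported] at hW
      exact hW (mem_vars_iff_mem_support i |>.2 ⟨_, m.degree_mem_support (psm_ne s t), hsub.2 hi⟩)
    apply hhf
    apply hf.2.2 _ hh.1 hh.2.1
    rw [hfe]
    apply psm_dvd
    · intro i hi
      by_contra hc
      exact hv1 i hi (by simp [v, hc])
    · intro i hi
      have h1 := hWt hi
      by_contra hc
      have h2 : i ∈ σ := by
        simp only [W, Finset.coe_union, Set.mem_union, Finset.mem_coe] at h1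
        tauto
      apply hv2 i hi
      simp only [v, h2, if_true]
      decide
  have key : ∀ (a : m.syn) (p : P n), m.toSyn (m.degree p) = a → p ∈ J →
      p ∈ supported (ZMod 2) W → eval v p = 0 := by
    intro a
    induction a using WellFoundedLT.induction with
    | ind a ih =>
    intro p hpa hpJ hpW
    by_cases hp : p = 0
    · simp [hp]
    obtain ⟨h, hh, hh0, hhp, hhf⟩ : ∃ h ∈ canonicalForm J, h ≠ 0 ∧ m.degree h ≤ m.degree p ∧
        h ≠ f := by
      obtain ⟨h, hh, hh0, hhp⟩ := hGB.2.2 p hpJ hp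
      by_cases hhf : h = f
      · subst hhf
        exact ⟨g, hg, IsPM.ne hg.1, hle.trans hhp, hne⟩
      · exact ⟨h, hh, hh0, hhp, hhf⟩
    have hdW : ((m.degree p).support : Set (Fin n)) ⊆ W := by
      intro i hi
      rw [mem_supported] at hpW
      exact hpW (mem_vars_iff_mem_support i |>.2 ⟨_, m.degree_mem_support hp, hi⟩)
    have hhW : h ∈ supported (ZMod 2) W := by
      obtain ⟨s, t, -, rfl⟩ := hh.1
      have := psm_sub m hhp
      exact psmW s t (fun i hi => hdW (this.1 hi)) (fun i hi => hdW (this.2 hi))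
    have hhv := hvan h hh hhf hhW
    by_cases hp0 : m.degree p = 0
    · exfalso
      have h0 : m.degree h = 0 := by
        rw [hp0] at hhp
        exact le_antisymm hhp zero_le
      have h1 := MonomialOrder.eq_C_of_degree_eq_zero h0
      rw [h1, eval_C] at hhv
      exact (m.leadingCoeff_ne_zero_iff.2 hh0) hhv
    have hlt := MonomialOrder.degree_reduce_lt (unitLC m hh0) hhp hp0
    have hr := ih _ (hpa ▸ hlt) _ rfl
      (sub_mem hpJ (J.mul_mem_left _ hh.2.1)) (sub_mem hpW (mul_mem ?_ hhW))
    · simpa [MonomialOrder.reduce, hhv] using hr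
    · rw [mem_supported]
      intro i hi
      obtain ⟨d, hd, hid⟩ := (mem_vars_iff_mem_support i).1 hi
      have := support_monomial_subset hd
      rw [Finset.mem_singleton] at this
      subst this
      apply hdW
      simp only [Finset.mem_coe, Finsupp.mem_support_iff, Finsupp.tsub_apply] at hid ⊢
      omega
  refine hfv (key _ f rfl hf.2.1 ?_)
  have := psm_sub m (le_refl (m.degree (psm σ τ)))
  rw [← hfe] at this
  rw [hfe]
  exact psmW _ _ (hfW _ this.1) (hfW _ this.2)

theorem gb_all (m m' : MonomialOrder.{0,u} (Fin n)) (J : Ideal (P n))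
    (hGB : IsGB m J (canonicalForm J)) : IsGB m' J (canonicalForm J) := by
  classical
  refine ⟨hGB.1, hGB.2.1, fun p hp hp0 => ?_⟩
  obtain ⟨q, r, hqr, hq, hr⟩ := m'.div_set (B := canonicalForm J)
    (fun b hb => unitLC m' (IsPM.ne hb.1)) p
  have hlin : Finsupp.linearCombination (P n) (fun b : canonicalForm J => (b : P n)) q ∈ J := by
    rw [Finsupp.linearCombination_apply]
    exact Submodule.sum_mem _ fun b _ => J.mul_mem_left _ b.2.2.1
  have hrJ : r ∈ J := by
    have : r = p - Finsupp.linearCombination (P n) (fun b : canonicalForm J => (b : P n)) q := by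
      rw [hqr]; ring
    rw [this]; exact sub_mem hp hlin
  have hr0 : r = 0 := by
    by_contra hne
    obtain ⟨h, hh, hh0, hle⟩ := hGB.2.2 r hrJ hne
    refine hr _ (m.degree_mem_support hne) h hh ?_
    rw [pm_degree m' m hh.1]; exact hle
  rw [hr0, add_zero, Finsupp.linearCombination_apply, Finsupp.sum] at hqr
  have hc : coeff (m'.degree p) p ≠ 0 := m'.coeff_degree_ne_zero_iff.2 hp0
  have hc' : coeff (m'.degree p) (∑ a ∈ q.support, q a • (a : P n)) ≠ 0 := by rwa [← hqr]
  rw [coeff_sum] at hc'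
  obtain ⟨b, -, hb⟩ := Finset.exists_ne_zero_of_sum_ne_zero hc'
  rw [smul_eq_mul, mul_comm] at hb
  have hb0 : q b ≠ 0 := by
    intro h; simp [h] at hb
  have hbb : (b : P n) ≠ 0 := IsPM.ne b.2.1
  have hdeg : m'.degree ((b : P n) * q b) = m'.degree p := by
    apply m'.toSyn.injective
    exact le_antisymm (hq b) (m'.le_degree (mem_support_iff.2 hb))
  refine ⟨b, b.2, hbb, ?_⟩
  change m'.degree (b : P n) ≤ m'.degree p
  rw [← hdeg, m'.degree_mul hbb hb0]
  exact le_self_add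

theorem bdd_mul {f g : P n} {a b : Fin n →₀ ℕ} (hf : ∀ d ∈ f.support, d ≤ a)
    (hg : ∀ d ∈ g.support, d ≤ b) : ∀ d ∈ (f * g).support, d ≤ a + b := by
  classical
  intro d hd
  obtain ⟨x, hx, y, hy, rfl⟩ := Finset.mem_add.1 (support_mul f g hd)
  exact add_le_add (hf x hx) (hg y hy)

theorem bdd_prod (s : Finset (Fin n)) (f : Fin n → P n) (a : Fin n → Fin n →₀ ℕ)
    (h : ∀ i, ∀ d ∈ (f i).support, d ≤ a i) :
    ∀ d ∈ (∏ i ∈ s, f i).support, d ≤ ∑ i ∈ s, a i := by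
  classical
  induction s using Finset.induction_on with
  | empty =>
    intro d hd
    rw [Finset.prod_empty, support_one, Finset.mem_singleton] at hd
    simp [hd]
  | insert i s hi ih =>
    rw [Finset.prod_insert hi, Finset.sum_insert hi]
    exact bdd_mul (h i) ih

theorem bdd_X (i : Fin n) : ∀ d ∈ (X i : P n).support, d ≤ Finsupp.single i 1 := by
  intro d hd
  rw [support_X, Finset.mem_singleton] at hd
  exact hd.le

theorem bdd_one_add_X (i : Fin n) : ∀ d ∈ (1 + X i : P n).support, d ≤ Finsupp.single i 1 := by
  classical
  intro d hd
  rcases Finset.mem_union.1 (support_add hd) with h | h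
  · rw [support_one, Finset.mem_singleton] at h
    rw [h]; exact zero_le
  · exact bdd_X i d h

theorem cf_reduced (m : MonomialOrder.{0,u} (Fin n)) (J : Ideal (P n))
    (hGB : IsGB m J (canonicalForm J)) : IsReducedGB m J (canonicalForm J) := by
  refine ⟨hGB, fun g hg => one_of_ne (m.coeff_degree_ne_zero_iff.2 (IsPM.ne hg.1)), ?_⟩
  intro f hf g hg hne d hd hle
  apply hne
  apply antichain m J hGB hf hg
  have hdf : d ≤ m.degree f := by
    obtain ⟨σ, τ, hdis, rfl⟩ := hf.1
    rw [degree_psm]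
    exact bdd_mul (bdd_prod _ _ _ bdd_X) (bdd_prod _ _ _ bdd_one_add_X) d hd
  exact le_trans hle hdf

theorem reduced_sub (m : MonomialOrder.{0,u} (Fin n)) (J : Ideal (P n)) {G₁ G₂ : Set (P n)}
    (h₁ : IsReducedGB m J G₁) (h₂ : IsReducedGB m J G₂) : G₁ ⊆ G₂ := by
  have red : ∀ {G : Set (P n)} (_ : IsReducedGB m J G) {f : P n} (_ : f ∈ G) {h : P n}
      (_ : h ∈ J) (_ : h ≠ 0) (_ : m.degree h ∈ f.support), m.degree h = m.degree f := by
    intro G hG f hf h hJ h0 hs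
    obtain ⟨k, hk, hk0, hkh⟩ := hG.1.2.2 h hJ h0
    by_cases hkf : k = f
    · subst hkf
      exact m.toSyn.injective (le_antisymm (m.le_degree hs) (m.toSyn_monotone hkh))
    · exact absurd hkh (hG.2.2 f hf k hk hkf _ hs)
  intro f hf
  have hf0 : f ≠ 0 := by
    rintro rfl
    simpa using h₁.2.1 _ hf
  obtain ⟨g, hg, hg0, hgf⟩ := h₁.1.2.1 hf |> fun h => h₂.1.2.2 f h hf0
  obtain ⟨f', hf', hf'0, hfg⟩ := h₁.1.2.2 g (h₂.1.2.1 hg) hg0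
  have hff : f' = f := by
    by_contra hne
    exact h₁.2.2 f hf f' hf' hne _ (m.degree_mem_support hf0) (hfg.trans hgf)
  subst hff
  have hdeg : m.degree g = m.degree f' := le_antisymm hgf hfg
  suffices f' - g = 0 by rw [sub_eq_zero.1 this]; exact hg
  by_contra hne
  have hJ : f' - g ∈ J := sub_mem (h₁.1.2.1 hf) (h₂.1.2.1 hg)
  have hmem := m.degree_mem_support hne
  have hd : m.degree (f' - g) = m.degree f' := by
    rcases Finset.mem_union.1 (support_sub _ _ _ hmem) with h | h
    · exact red h₁ hf hJ hne h
    · rw [red h₂ hg hJ hne h, hdeg]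
  rw [mem_support_iff, hd, coeff_sub] at hmem
  have e1 := h₁.2.1 _ hf
  have e2 := h₂.2.1 _ hg
  rw [leadDeg_eq] at e1 e2
  rw [hdeg] at e2
  rw [e1, e2] at hmem
  exact hmem (sub_self _)

theorem exists_reduced (m : MonomialOrder.{0,u} (Fin n)) (J : Ideal (P n)) :
    ∃ G, IsReducedGB m J G := by
  classical
  let L : Set (Fin n →₀ ℕ) := {d | ∃ f ∈ J, f ≠ 0 ∧ m.degree f = d}
  let M : Set (Fin n →₀ ℕ) := {d | Minimal (· ∈ L) d}
  have hM : M.Finite := by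
    apply WellQuasiOrderedLE.finite_of_isAntichain
    exact setOfPred_minimal_antichain _
  have hex : ∀ d ∈ L, ∃ f ∈ J, m.degree f = d ∧ coeff d f = 1 ∧
      ∀ e ∈ f.support, e ≠ d → ∀ l ∈ L, ¬ l ≤ e := by
    intro d hd
    obtain ⟨q, r, hqr, hq, hr⟩ := m.div_set (B := {f | f ∈ J ∧ f ≠ 0})
      (fun b hb => unitLC m hb.2) (monomial d 1 : P n)
    set s := Finsupp.linearCombination (P n) (fun b : {f : P n | f ∈ J ∧ f ≠ 0} => (b : P n)) q
    have hs : s ∈ J := by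
      simp only [s]
      rw [Finsupp.linearCombination_apply]
      exact Submodule.sum_mem _ fun b _ => J.mul_mem_left _ b.2.1
    have hrL : ∀ e ∈ r.support, ∀ l ∈ L, ¬ l ≤ e := by
      rintro e he l ⟨f, hf, hf0, rfl⟩
      exact hr e he f ⟨hf, hf0⟩
    have hrd : coeff d r = 0 := by
      by_contra h
      exact hrL d (mem_support_iff.2 h) d hd le_rfl
    have hse : s = monomial d 1 - r := by rw [hqr]; ring
    have hsd : coeff d s = 1 := by simp [hse, hrd]
    have hs0 : s ≠ 0 := by intro h; simp [h] at hsd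
    have hsup : ∀ e ∈ s.support, e ≠ d → ∀ l ∈ L, ¬ l ≤ e := by
      intro e he hed
      apply hrL
      rw [mem_support_iff, hse, coeff_sub, coeff_monomial, if_neg (Ne.symm hed), zero_sub,
        neg_ne_zero] at he
      exact mem_support_iff.2 he
    refine ⟨s, hs, ?_, hsd, hsup⟩
    by_contra hne
    exact hsup _ (m.degree_mem_support hs0) hne _ ⟨s, hs, hs0, rfl⟩ le_rfl
  choose! F hFJ hFd hFc hFs using hex
  have hML : M ⊆ L := fun d hd => hd.1
  refine ⟨F '' M, ⟨hM.image _, ?_, ?_⟩, ?_, ?_⟩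
  · rintro _ ⟨d, hd, rfl⟩
    exact hFJ d (hML hd)
  · intro f hf hf0
    have : m.degree f ∈ L := ⟨f, hf, hf0, rfl⟩
    obtain ⟨d, hdle, hd⟩ := exists_minimal_le_of_wellFoundedLT (· ∈ L) _ this
    refine ⟨F d, ⟨d, hd, rfl⟩, ?_, ?_⟩
    · intro h
      have := hFc d hd.1
      simp [h] at this
    · rw [leadDeg_eq, hFd d hd.1]; exact hdle
  · rintro _ ⟨d, hd, rfl⟩
    rw [leadDeg_eq, hFd d hd.1]; exact hFc d hd.1
  · rintro _ ⟨d, hd, rfl⟩ _ ⟨d', hd', rfl⟩ hne e he hle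
    rw [leadDeg_eq, hFd d' hd'.1] at hle
    by_cases hed : e = d
    · subst hed
      have := hd.eq_of_le hd'.1 hle
      subst this
      exact hne rfl
    · exact hFs d hd.1 e he hed d' hd'.1 hle

end NeuralAux

/-- TFAE: (1) the canonical form is a Gröbner basis for some monomial ordering;
(2) the canonical form equals the universal Gröbner basis; (3) every element of the universal
Gröbner basis is a pseudo-monomial. -/
theorem stmt12 {n : ℕ} (Co : Set (Fin n → ZMod 2)) :
    ((∃ m : MonomialOrder.{0,u} (Fin n),
        IsGB m (neuralIdeal Co) (canonicalForm (neuralIdeal Co))) ↔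
      canonicalForm (neuralIdeal Co) = universalGB.{u} (neuralIdeal Co)) ∧
    (canonicalForm (neuralIdeal Co) = universalGB.{u} (neuralIdeal Co) ↔
      ∀ f ∈ universalGB.{u} (neuralIdeal Co), IsPseudoMonomial f) := by
  set J := neuralIdeal Co
  have h12 : (∃ m : MonomialOrder.{0,u} (Fin n), IsGB m J (canonicalForm J)) →
      canonicalForm J = universalGB.{u} J := by
    rintro ⟨m, hm⟩
    ext f
    constructor
    · intro hf
      exact ⟨m, _, NeuralAux.cf_reduced m J hm, hf⟩
    · rintro ⟨m', G, hG, hf⟩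
      exact NeuralAux.reduced_sub m' J hG
        (NeuralAux.cf_reduced m' J (NeuralAux.gb_all m m' J hm)) hf
  have h23 : canonicalForm J = universalGB.{u} J →
      ∀ f ∈ universalGB.{u} J, IsPseudoMonomial f := by
    intro h f hf
    rw [← h] at hf
    exact hf.1
  have h31 : (∀ f ∈ universalGB.{u} J, IsPseudoMonomial f) →
      ∃ m : MonomialOrder.{0,u} (Fin n), IsGB m J (canonicalForm J) := by
    intro h
    obtain ⟨m⟩ := NeuralAux.exists_order.{u} (n := n)
    obtain ⟨G, hG⟩ := NeuralAux.exists_reduced m J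
    refine ⟨m, NeuralAux.cf_finite J, NeuralAux.cf_sub J, fun f hf hf0 => ?_⟩
    obtain ⟨g, hg, hg0, hle⟩ := hG.1.2.2 f hf hf0
    obtain ⟨k, hk, c, hc⟩ := NeuralAux.exists_cf J (h g ⟨m, G, hG, hg⟩) (hG.1.2.1 hg)
    have hk0 := NeuralAux.IsPM.ne hk.1
    refine ⟨k, hk, hk0, le_trans ?_ hle⟩
    have hc0 : c ≠ 0 := by
      rintro rfl
      exact hg0 (by simpa using hc)
    rw [NeuralAux.leadDeg_eq, NeuralAux.leadDeg_eq, hc, m.degree_mul hk0 hc0]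
    exact le_self_add
  exact ⟨⟨h12, fun h => h31 (h23 h)⟩, ⟨h23, fun h => h12 (h31 h)⟩⟩
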